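/- Let m be a positive integer or half-integer (2m ∈ ℕ) and s ∈ ℤ + 1/2. Let τ lie in the upper half-plane and z₁, z₂ ∈ ℂ with z₁ ∉ ℤ + ℤτ. Set f_{j,k} := (−1)^j q^{(m+1/2)(j+s/(2m+1))² − k²/(4m)} e^{−2πijm(z₁−z₂)+πik(z₁−z₂)}. Then θ^{(−)}_{s,m+1/2}(τ, −2m(z₁−z₂)/(2m+1)) · Φ₁^{[m,0]}(τ, z₁, z₂) − e^{−2πims(z₁−z₂)/(2m+1)} (∑_{j,k∈ℤ, 0≤k<2mj} − ∑_{j,k∈ℤ, 2mj≤k<0}) f_{j,k} θ_{k,m}(τ, z₁+z₂) = −i θ^{(−)}_{s,m+1/2}(τ, z₁+z₂+(z₁−z₂)/(2m+1)) · η(τ)³ / ϑ₁₁(τ, z₁). -/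

import Mathlib

noncomputable section

open Complex

/-- `e2 w = exp (2 π i w)`; with `q = e^{2πiτ}`, the power `q^x` corresponds to `e2 (x * τ)`. -/
def e2 (w : ℂ) : ℂ := Complex.exp (2 * (Real.pi : ℂ) * Complex.I * w)

/-- Jacobi-type theta function `θ^{(ε)}_{n,m}(τ, z) = ∑_{j∈ℤ} ε^j q^{m(j+n/(2m))²} e^{2πim(j+n/(2m))z}`. -/
def jtheta (ε n m τ z : ℂ) : ℂ :=
  ∑' j : ℤ, ε ^ j *
    e2 (m * ((j : ℂ) + n / (2 * m)) ^ 2 * τ + m * ((j : ℂ) + n / (2 * m)) * z)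

/-- Mock theta function `Φ₁^{(ε)[m,s]}(τ, z₁, z₂)`. -/
def Phi1 (ε m s τ z₁ z₂ : ℂ) : ℂ :=
  ∑' j : ℤ, ε ^ j *
    e2 (m * (j : ℂ) * (z₁ + z₂) + s * z₁ + (m * (j : ℂ) ^ 2 + s * (j : ℂ)) * τ) /
      (1 - e2 (z₁ + (j : ℂ) * τ))

/-- Dedekind eta function `η(τ) = q^{1/24} ∏_{k≥1} (1 - q^k)`. -/
def dedekindEta (τ : ℂ) : ℂ := e2 (τ / 24) * ∏' k : ℕ, (1 - e2 (((k : ℂ) + 1) * τ))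

/-- Jacobi theta `ϑ₁₁(τ, z) = i ∑_{j∈ℤ} (−1)^j q^{(j+1/2)²/2} e^{2πi(j+1/2)z}`. -/
def theta11 (τ z : ℂ) : ℂ :=
  Complex.I * ∑' j : ℤ, (-1 : ℂ) ^ j *
    e2 (((j : ℂ) + 1 / 2) ^ 2 / 2 * τ + ((j : ℂ) + 1 / 2) * z)

/-- Indefinite double sum `(∑_{j,p∈ℤ, 0<p≤j} − ∑_{j,p∈ℤ, j<p≤0}) f j p`. -/
def indefSum (f : ℤ → ℤ → ℂ) : ℂ :=
  ∑' jp : ℤ × ℤ,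
    ((if 0 < jp.2 ∧ jp.2 ≤ jp.1 then f jp.1 jp.2 else 0) -
      (if jp.1 < jp.2 ∧ jp.2 ≤ 0 then f jp.1 jp.2 else 0))

/-- `g^{[m]}_{n,ν}(τ)`. -/
def gfun (m : ℂ) (n ν : ℤ) (τ : ℂ) : ℂ :=
  indefSum fun j p =>
    (-1 : ℂ) ^ j *
      e2 (((m + 1 / 2) * ((j : ℂ) + (ν : ℂ) - ((ν : ℂ) + 1 / 2) / (2 * m + 1)) ^ 2 -
        m * ((p : ℂ) + (ν : ℂ) - (n : ℂ) / (2 * m)) ^ 2) * τ)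

/-- `h^{[m]}_{n,ν}(τ, z)`. -/
def hfun (m : ℂ) (n ν : ℤ) (τ z : ℂ) : ℂ :=
  ∑' j : ℤ,
    e2 (m * (j : ℂ) * z + (n : ℂ) * z / 2 +
        (m * (j : ℂ) ^ 2 + (n : ℂ) * ((j : ℂ) + (ν : ℂ))) * τ) /
      (1 - e2 (m * z + 2 * m * ((j : ℂ) + (ν : ℂ)) * τ))

/-- `G^{[m]}_{n,ν}(τ, z)`. -/
def Gfun (m : ℂ) (n ν : ℤ) (τ z : ℂ) : ℂ :=
  gfun m n ν τ * jtheta 1 (n : ℂ) m τ z +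
    (-1 : ℂ) ^ ν * e2 (-(m * (ν : ℂ) ^ 2) * τ) *
      jtheta (-1) ((ν : ℂ) + 1 / 2) (m + 1 / 2) τ 0 * hfun m n ν τ z

/-- `F^{[m](a,b)}_{n,ν}(τ, z)`. -/
def Ffun (m : ℂ) (a b n ν : ℤ) (τ z : ℂ) : ℂ :=
  e2 ((a : ℂ) * z / 2 + (a : ℂ) ^ 2 / (4 * m) * τ) *
    Gfun m n ν τ (z + (a : ℂ) * τ / m + (b : ℂ) / m)

/-- The coefficient `f_{j,k}` of Lemma 3.1:
`f_{j,k} = (−1)^j q^{(m+1/2)(j+s/(2m+1))² − k²/(4m)} e^{−2πijm(z₁−z₂)+πik(z₁−z₂)}`. -/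
def fcoef (m s τ z₁ z₂ : ℂ) (j k : ℤ) : ℂ :=
  (-1 : ℂ) ^ j *
    e2 (((m + 1 / 2) * ((j : ℂ) + s / (2 * m + 1)) ^ 2 - (k : ℂ) ^ 2 / (4 * m)) * τ +
      (-((j : ℂ) * m) + (k : ℂ) / 2) * (z₁ - z₂))

/-- Finite `q`-Pochhammer symbol `(q)_n`. -/
def qP (q : ℂ) (n : ℕ) : ℂ := ∏ k ∈ Finset.range n, (1 - q ^ (k + 1))

/-- `1/(q)_k`, extended by zero to negative `k`. -/
def qr (q : ℂ) (k : ℤ) : ℂ := if 0 ≤ k then (qP q k.toNat)⁻¹ else 0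

lemma one_sub_pow_ne {q : ℂ} (hq : ‖q‖ < 1) (k : ℕ) : 1 - q ^ (k + 1) ≠ 0 := by
  intro h
  have h1 : ‖q ^ (k + 1)‖ < 1 := by
    rw [norm_pow]; exact pow_lt_one₀ (norm_nonneg _) hq (by omega)
  rw [← sub_eq_zero.mp h] at h1
  simp at h1

lemma qP_ne {q : ℂ} (hq : ‖q‖ < 1) (n : ℕ) : qP q n ≠ 0 :=
  Finset.prod_ne_zero_iff.mpr fun k _ => one_sub_pow_ne hq k

lemma qr_rec {q : ℂ} (hq : ‖q‖ < 1) (k : ℤ) : (1 - q ^ k) * qr q k = qr q (k - 1) := by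
  rcases lt_trichotomy k 0 with h | h | h
  · simp [qr, not_le.mpr h]
    intro h1; omega
  · subst h; simp [qr]
  · obtain ⟨n, rfl⟩ : ∃ n : ℕ, k = n + 1 := ⟨(k - 1).toNat, by omega⟩
    have h1 : ((n : ℤ) + 1).toNat = n + 1 := by omega
    have h2 : (0 : ℤ) ≤ n + 1 := by omega
    simp only [qr, h1, h2, if_true, add_sub_cancel_right, Int.natCast_nonneg, Int.toNat_natCast]
    have h3 := qP_ne hq n
    have h4 := one_sub_pow_ne hq n
    have h5 : q ^ ((n : ℤ) + 1) = q ^ (n + 1) := by norm_cast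
    rw [h5, qP, Finset.prod_range_succ, ← qP]
    field_simp

lemma qr_neg (q : ℂ) {k : ℤ} (h : k < 0) : qr q k = 0 := by simp [qr, not_le.mpr h]

lemma summable_fin (q : ℂ) (f : ℤ → ℂ) (a b : ℕ) :
    Summable fun i : ℤ => f i * (qr q (a - i) * qr q (b + i)) := by
  apply summable_of_ne_finset_zero (s := Finset.Icc (-(b : ℤ)) a)
  intro i hi
  simp only [Finset.mem_Icc, not_and_or, not_le] at hi
  rcases hi with h | h
  · rw [qr_neg q (k := b + i) (by omega)]; simp
  · rw [qr_neg q (k := a - i) (by omega)]; simp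

/-- finite theta sums -/
def qF (q : ℂ) (g : ℤ → ℂ) (x : ℂ) (a b : ℕ) : ℂ :=
  ∑' i : ℤ, g i * x ^ i * (qr q (a - i) * qr q (b + i))

/-- finite partial fraction sums -/
def qA (q : ℂ) (g : ℤ → ℂ) (x : ℂ) (a b : ℕ) : ℂ :=
  ∑' i : ℤ, g i * q ^ i / (1 - x * q ^ i) * (qr q (a - i) * qr q (b + i))

section
variable {q : ℂ} {g : ℤ → ℂ}

lemma qF_zero (hg0 : g 0 = 1) (x : ℂ) : qF q g x 0 0 = 1 := by
  rw [qF, tsum_eq_single 0]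
  · simp [hg0, qr, qP]
  · intro i hi
    rcases lt_or_gt_of_ne hi with h | h
    · rw [qr_neg q (k := ((0 : ℕ) : ℤ) + i) (by simpa using h)]; simp
    · rw [qr_neg q (k := ((0 : ℕ) : ℤ) - i) (by simpa using h)]; simp

lemma qA_zero (hg0 : g 0 = 1) (x : ℂ) : qA q g x 0 0 = 1 / (1 - x) := by
  rw [qA, tsum_eq_single 0]
  · simp [hg0, qr, qP]
  · intro i hi
    rcases lt_or_gt_of_ne hi with h | h
    · rw [qr_neg q (k := ((0 : ℕ) : ℤ) + i) (by simpa using h)]; simp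
    · rw [qr_neg q (k := ((0 : ℕ) : ℤ) - i) (by simpa using h)]; simp

lemma qF_succ_left (hq : ‖q‖ < 1) (hq0 : q ≠ 0) (hg : ∀ i, g (i + 1) = -q ^ i * g i)
    {x : ℂ} (hx : x ≠ 0) (a b : ℕ) :
    (1 - q ^ (a + b + 1)) * qF q g x (a + 1) b = (1 - x * q ^ a) * qF q g x a b := by
  have e : ∑' i : ℤ, g (i - 1) * x ^ (i - 1) * (qr q (a - (i - 1)) * qr q (b + (i - 1)))
      = qF q g x a b :=
    (Equiv.subRight (1 : ℤ)).tsum_eq (fun i => g i * x ^ i * (qr q (a - i) * qr q (b + i)))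
  have hs : Summable fun i : ℤ => g (i - 1) * x ^ (i - 1) * (qr q (a - (i - 1)) * qr q (b + (i - 1))) :=
    (Equiv.subRight (1 : ℤ)).summable_iff.mpr (summable_fin q (fun i => g i * x ^ i) a b)
  rw [sub_mul (1 : ℂ) (x * q ^ a), one_mul]
  nth_rewrite 2 [← e]
  rw [qF, qF, ← tsum_mul_left, ← tsum_mul_left,
    ← (summable_fin q (fun i => g i * x ^ i) a b).tsum_sub (hs.mul_left _)]
  congr 1; ext i
  have h1 := qr_rec hq ((a : ℤ) + 1 - i)
  have h2 := qr_rec hq ((b : ℤ) + i)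
  have h3 := hg (i - 1)
  rw [sub_add_cancel] at h3
  have e1 : (a : ℤ) + 1 - i - 1 = a - i := by ring
  have e2 : (a : ℤ) - (i - 1) = a + 1 - i := by ring
  have e3 : (b : ℤ) + (i - 1) = b + i - 1 := by ring
  rw [e1] at h1
  rw [e2, e3, ← h1, ← h2, h3]
  push_cast
  have k1 : q ^ ((a : ℤ) + 1 - i) = q ^ a * q / q ^ i := by
    rw [zpow_sub₀ hq0, zpow_add₀ hq0]; simp
  have k2 : q ^ ((b : ℤ) + i) = q ^ b * q ^ i := by
    rw [zpow_add₀ hq0]; simp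
  have k3 : q ^ (i - 1) = q ^ i / q := by
    rw [zpow_sub₀ hq0]; simp
  have k4 : x ^ (i - 1) = x ^ i / x := by
    rw [zpow_sub₀ hx]; simp
  rw [k1, k2, k3, k4, pow_succ, pow_add]
  have := zpow_ne_zero i hq0
  field_simp
  ring

lemma qF_succ_right (hq : ‖q‖ < 1) (hq0 : q ≠ 0) (hg : ∀ i, g (i + 1) = -q ^ i * g i)
    {x : ℂ} (hx : x ≠ 0) (a b : ℕ) :
    (1 - q ^ (a + b + 1)) * qF q g x a (b + 1) = (1 - q ^ (b + 1) / x) * qF q g x a b := by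
  have e : ∑' i : ℤ, g (i + 1) * x ^ (i + 1) * (qr q (a - (i + 1)) * qr q (b + (i + 1)))
      = qF q g x a b :=
    (Equiv.addRight (1 : ℤ)).tsum_eq (fun i => g i * x ^ i * (qr q (a - i) * qr q (b + i)))
  have hs : Summable fun i : ℤ => g (i + 1) * x ^ (i + 1) * (qr q (a - (i + 1)) * qr q (b + (i + 1))) :=
    (Equiv.addRight (1 : ℤ)).summable_iff.mpr (summable_fin q (fun i => g i * x ^ i) a b)
  rw [sub_mul (1 : ℂ) (q ^ (b + 1) / x), one_mul]
  nth_rewrite 2 [← e]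
  rw [qF, qF, ← tsum_mul_left, ← tsum_mul_left,
    ← (summable_fin q (fun i => g i * x ^ i) a b).tsum_sub (hs.mul_left _)]
  congr 1; ext i
  have h1 := qr_rec hq ((a : ℤ) - i)
  have h2 := qr_rec hq ((b : ℤ) + 1 + i)
  have h3 := hg i
  have e1 : (b : ℤ) + 1 + i - 1 = b + i := by ring
  have e2 : (a : ℤ) - (i + 1) = a - i - 1 := by ring
  have e3 : (b : ℤ) + (i + 1) = b + 1 + i := by ring
  rw [e1] at h2
  rw [e2, e3, ← h1, ← h2, h3]
  push_cast
  have k1 : q ^ ((a : ℤ) - i) = q ^ a / q ^ i := by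
    rw [zpow_sub₀ hq0]; simp
  have k2 : q ^ ((b : ℤ) + 1 + i) = q ^ b * q * q ^ i := by
    rw [zpow_add₀ hq0, zpow_add₀ hq0]; simp
  have k4 : x ^ (i + 1) = x ^ i * x := by
    rw [zpow_add₀ hx]; simp
  rw [k1, k2, k4, pow_succ, pow_add]
  have := zpow_ne_zero i hq0
  field_simp
  ring

/-- finite product -/
def qD (q x : ℂ) (n : ℕ) : ℂ := ∏ k ∈ Finset.range n, ((1 - x * q ^ k) * (1 - q ^ (k + 1) / x))

lemma qF_eq (hq : ‖q‖ < 1) (hq0 : q ≠ 0) (hg0 : g 0 = 1) (hg : ∀ i, g (i + 1) = -q ^ i * g i)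
    {x : ℂ} (hx : x ≠ 0) (n : ℕ) :
    qP q (2 * n) * qF q g x n n = qD q x n := by
  induction n with
  | zero => simp [qP, qD, qF_zero hg0]
  | succ n ih =>
    have h1 := qF_succ_left hq hq0 hg hx n (n + 1)
    have h2 := qF_succ_right hq hq0 hg hx n n
    rw [qD, Finset.prod_range_succ, ← qD, ← ih]
    rw [show 2 * (n + 1) = n + n + 1 + 1 by ring, qP, Finset.prod_range_succ,
      Finset.prod_range_succ, ← qP, show n + n = 2 * n by ring] 
    rw [show n + (n + 1) + 1 = 2 * n + 1 + 1 by ring] at h1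
    rw [show n + n + 1 = 2 * n + 1 by ring] at h2
    linear_combination qP q (2 * n) * (1 - q ^ (2 * n + 1)) * h1 +
      qP q (2 * n) * (1 - x * q ^ n) * h2

lemma qF_one (hq : ‖q‖ < 1) (hq0 : q ≠ 0) (hg : ∀ i, g (i + 1) = -q ^ i * g i) (a b : ℕ) :
    qF q g 1 (a + 1) b = 0 := by
  induction a with
  | zero =>
    have h := qF_succ_left hq hq0 hg one_ne_zero 0 b
    simp only [pow_zero, mul_one, sub_self, zero_mul] at h
    exact (mul_eq_zero.mp h).resolve_left (one_sub_pow_ne hq _)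
  | succ a ih =>
    have h := qF_succ_left hq hq0 hg one_ne_zero (a + 1) b
    rw [ih, mul_zero] at h
    exact (mul_eq_zero.mp h).resolve_left (one_sub_pow_ne hq _)

lemma qF_q (hq : ‖q‖ < 1) (hq0 : q ≠ 0) (hg : ∀ i, g (i + 1) = -q ^ i * g i) (a b : ℕ) :
    qF q g q a (b + 1) = 0 := by
  induction b with
  | zero =>
    have h := qF_succ_right hq hq0 hg hq0 a 0
    simp only [zero_add, pow_one, div_self hq0, sub_self, zero_mul] at h
    exact (mul_eq_zero.mp h).resolve_left (one_sub_pow_ne hq _)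
  | succ b ih =>
    have h := qF_succ_right hq hq0 hg hq0 a (b + 1)
    rw [ih, mul_zero] at h
    exact (mul_eq_zero.mp h).resolve_left (one_sub_pow_ne hq _)

lemma qA_succ_left (hq : ‖q‖ < 1) (hq0 : q ≠ 0) (hg : ∀ i, g (i + 1) = -q ^ i * g i)
    {x : ℂ} (hx : ∀ i : ℤ, 1 - x * q ^ i ≠ 0) (a b : ℕ) :
    (1 - x * q ^ (a + 1)) * qA q g x (a + 1) b = qA q g x a b := by
  have h0 := qF_one hq hq0 hg a b
  rw [← add_zero (qA q g x a b), ← mul_zero (q ^ (a + 1)), ← h0, qA, qA, qF, ← tsum_mul_left,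
    ← tsum_mul_left, ← (summable_fin q _ a b).tsum_add ((summable_fin q _ (a + 1) b).mul_left _)]
  congr 1; ext i
  have h1 := qr_rec hq ((a : ℤ) + 1 - i)
  have e1 : (a : ℤ) + 1 - i - 1 = a - i := by ring
  rw [e1] at h1
  rw [← h1]
  push_cast
  have k1 : q ^ ((a : ℤ) + 1 - i) = q ^ (a + 1) / q ^ i := by
    rw [zpow_sub₀ hq0, zpow_add₀ hq0]; simp [pow_succ]
  rw [k1]
  have := zpow_ne_zero i hq0
  have := hx i
  simp only [one_zpow]
  field_simp
  ring

lemma qA_succ_right (hq : ‖q‖ < 1) (hq0 : q ≠ 0) (hg : ∀ i, g (i + 1) = -q ^ i * g i)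
    {x : ℂ} (hx0 : x ≠ 0) (hx : ∀ i : ℤ, 1 - x * q ^ i ≠ 0) (a b : ℕ) :
    (1 - q ^ (b + 1) / x) * qA q g x a (b + 1) = qA q g x a b := by
  have h0 := qF_q hq hq0 hg a b
  rw [← add_zero (qA q g x a b), ← mul_zero (-(q ^ (b + 1) / x)), ← h0, qA, qA, qF, ← tsum_mul_left,
    ← tsum_mul_left, ← (summable_fin q _ a b).tsum_add ((summable_fin q _ a (b + 1)).mul_left _)]
  congr 1; ext i
  have h1 := qr_rec hq ((b : ℤ) + 1 + i)
  have e1 : (b : ℤ) + 1 + i - 1 = b + i := by ring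
  rw [e1] at h1
  rw [← h1]
  push_cast
  have k1 : q ^ ((b : ℤ) + 1 + i) = q ^ (b + 1) * q ^ i := by
    rw [zpow_add₀ hq0, zpow_add₀ hq0]; simp [pow_succ]
  rw [k1]
  have := hx i
  field_simp
  ring

lemma qA_eq (hq : ‖q‖ < 1) (hq0 : q ≠ 0) (hg0 : g 0 = 1) (hg : ∀ i, g (i + 1) = -q ^ i * g i)
    {x : ℂ} (hx0 : x ≠ 0) (hx : ∀ i : ℤ, 1 - x * q ^ i ≠ 0) (n : ℕ) :
    qD q x n * (1 - x * q ^ n) * qA q g x n n = 1 := by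
  induction n with
  | zero =>
    have := hx 0
    simp only [zpow_zero, mul_one] at this
    simp [qD, qA_zero hg0, mul_inv_cancel₀ this]
  | succ n ih =>
    have h1 := qA_succ_left hq hq0 hg hx n (n + 1)
    have h2 := qA_succ_right hq hq0 hg hx0 hx n n
    rw [qD, Finset.prod_range_succ, ← qD]
    rw [← h2, ← h1] at ih
    linear_combination ih

lemma qFA (hq : ‖q‖ < 1) (hq0 : q ≠ 0) (hg0 : g 0 = 1) (hg : ∀ i, g (i + 1) = -q ^ i * g i)
    {x : ℂ} (hx0 : x ≠ 0) (hx : ∀ i : ℤ, 1 - x * q ^ i ≠ 0) (n : ℕ) :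
    qP q (2 * n) * qF q g x n n * (1 - x * q ^ n) * qA q g x n n = 1 := by
  rw [qF_eq hq hq0 hg0 hg hx0, qA_eq hq hq0 hg0 hg hx0 hx]

end
open Filter Topology in
lemma qP_tendsto {q : ℂ} (hq : ‖q‖ < 1) :
    Tendsto (qP q) atTop (𝓝 (∏' k : ℕ, (1 - q ^ (k + 1)))) :=
  (ModularForm.multipliable_one_sub_pow hq).hasProd.tendsto_prod_nat

lemma qQ_ne {q : ℂ} (hq : ‖q‖ < 1) : ∏' k : ℕ, (1 - q ^ (k + 1)) ≠ 0 := by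
  simp_rw [sub_eq_add_neg]
  refine tprod_one_add_ne_zero_of_summable (f := fun n : ℕ ↦ -q ^ (n + 1)) ?_ ?_
  · intro i; rw [← sub_eq_add_neg]; exact one_sub_pow_ne hq i
  · simp only [norm_neg, norm_pow]
    exact (summable_nat_add_iff 1).mpr (summable_geometric_of_lt_one (norm_nonneg _) hq)

open Filter Topology in
lemma qr_nat_tendsto {q : ℂ} (hq : ‖q‖ < 1) :
    Tendsto (qr q) atTop (𝓝 (∏' k : ℕ, (1 - q ^ (k + 1)))⁻¹) := by
  have h : Tendsto (fun k : ℤ => (qP q k.toNat)⁻¹) atTop (𝓝 (∏' k : ℕ, (1 - q ^ (k + 1)))⁻¹) := by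
    apply Tendsto.inv₀ _ (qQ_ne hq)
    apply (qP_tendsto hq).comp
    refine tendsto_atTop.mpr fun b => ?_
    filter_upwards [eventually_ge_atTop (b : ℤ)] with k hk
    omega
  apply h.congr'
  filter_upwards [eventually_ge_atTop (0 : ℤ)] with k hk
  simp [qr, hk]

open Filter Topology in
lemma qr_bdd {q : ℂ} (hq : ‖q‖ < 1) : ∃ C : ℝ, 0 ≤ C ∧ ∀ k, ‖qr q k‖ ≤ C := by
  have h : Tendsto (fun n : ℕ => (qP q n)⁻¹) atTop (𝓝 (∏' k : ℕ, (1 - q ^ (k + 1)))⁻¹) :=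
    Tendsto.inv₀ (qP_tendsto hq) (qQ_ne hq)
  obtain ⟨C, hC⟩ := (Metric.isBounded_range_of_tendsto _ h).exists_norm_le
  have hC0 : 0 ≤ C := (norm_nonneg _).trans (hC _ ⟨0, rfl⟩)
  refine ⟨C, hC0, fun k => ?_⟩
  by_cases hk : 0 ≤ k
  · simp only [qr, hk, if_true]; exact hC _ ⟨_, rfl⟩
  · simp [qr, hk, hC0]

open Filter Topology in
lemma qlim {q : ℂ} (hq : ‖q‖ < 1) (f : ℤ → ℂ) (hf : Summable fun i => ‖f i‖) :
    Tendsto (fun n : ℕ => ∑' i : ℤ, f i * (qr q (n - i) * qr q (n + i))) atTop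
      (𝓝 ((∑' i, f i) * ((∏' k : ℕ, (1 - q ^ (k + 1)))⁻¹) ^ 2)) := by
  obtain ⟨C, hC0, hC⟩ := qr_bdd hq
  rw [← tsum_mul_right]
  apply tendsto_tsum_of_dominated_convergence (bound := fun i => ‖f i‖ * (C * C))
    (hf.mul_right _)
  · intro i
    apply Tendsto.const_mul
    rw [sq]
    apply Tendsto.mul
    · apply (qr_nat_tendsto hq).comp
      exact tendsto_atTop_add_const_right _ (-i) tendsto_natCast_atTop_atTop
    · apply (qr_nat_tendsto hq).comp
      exact tendsto_atTop_add_const_right _ i tendsto_natCast_atTop_atTop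
  · refine Eventually.of_forall fun n i => ?_
    rw [norm_mul, norm_mul]
    gcongr
    · exact hC _
    · exact hC _

open Filter Topology in
/-- The basic partial fraction/triple product identity. -/
lemma theta_mul_appell {q : ℂ} {g : ℤ → ℂ} (hq : ‖q‖ < 1) (hq0 : q ≠ 0) (hg0 : g 0 = 1)
    (hg : ∀ i, g (i + 1) = -q ^ i * g i)
    {x : ℂ} (hx0 : x ≠ 0) (hx : ∀ i : ℤ, 1 - x * q ^ i ≠ 0)
    (h1 : Summable fun i => ‖g i * x ^ i‖)
    (h2 : Summable fun i => ‖g i * q ^ i / (1 - x * q ^ i)‖) :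
    (∑' i, g i * x ^ i) * (∑' i, g i * q ^ i / (1 - x * q ^ i)) =
      (∏' k : ℕ, (1 - q ^ (k + 1))) ^ 3 := by
  have hQ := qQ_ne hq
  have l1 := qlim hq _ h1
  have l2 := qlim hq _ h2
  have l3 : Tendsto (fun n : ℕ => qP q (2 * n)) atTop (𝓝 (∏' k : ℕ, (1 - q ^ (k + 1)))) :=
    (qP_tendsto hq).comp (tendsto_id.const_mul_atTop' (by norm_num))
  have l4 : Tendsto (fun n : ℕ => 1 - x * q ^ n) atTop (𝓝 (1 - x * 0)) :=
    ((tendsto_pow_atTop_nhds_zero_of_norm_lt_one hq).const_mul x).const_sub 1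
  have l5 := ((l3.mul l1).mul l4).mul l2
  have l6 := l5.congr (fun n => qFA hq hq0 hg0 hg hx0 hx n)
  have := tendsto_nhds_unique l6 tendsto_const_nhds
  field_simp at this
  linear_combination this

open Filter Topology in
lemma inv_bdd {q : ℂ} (hq : ‖q‖ < 1) (hq0 : q ≠ 0) {x : ℂ} (hx0 : x ≠ 0) :
    ∃ C : ℝ, ∀ i : ℤ, ‖(1 - x * q ^ i)⁻¹‖ ≤ C := by
  have l0 := tendsto_pow_atTop_nhds_zero_of_norm_lt_one hq
  have l1 : Tendsto (fun n : ℕ => (1 - x * q ^ n)⁻¹) atTop (𝓝 (1 - x * 0)⁻¹) :=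
    ((l0.const_mul x).const_sub 1).inv₀ (by simp)
  have l2 : Tendsto (fun n : ℕ => q ^ n * (q ^ n - x)⁻¹) atTop (𝓝 (0 * (0 - x)⁻¹)) :=
    l0.mul ((l0.sub_const x).inv₀ (by simpa using hx0))
  obtain ⟨C, hC⟩ := (Metric.isBounded_range_of_tendsto _ l1).exists_norm_le
  obtain ⟨D, hD⟩ := (Metric.isBounded_range_of_tendsto _ l2).exists_norm_le
  refine ⟨max C D, fun i => ?_⟩
  obtain ⟨n, rfl | rfl⟩ := i.eq_nat_or_neg
  · exact (hC _ ⟨n, by simp⟩).trans (le_max_left _ _)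
  · refine le_trans (le_of_eq ?_) ((hD _ ⟨n, rfl⟩).trans (le_max_right _ _))
    congr 1
    have := pow_ne_zero n hq0
    rw [zpow_neg, zpow_natCast]
    have : 1 - x * (q ^ n)⁻¹ = (q ^ n - x) / q ^ n := by field_simp
    rw [this, inv_div, div_eq_mul_inv]

/-- Shifting the Appell-type sum. -/
lemma appell_shift {q : ℂ} {g : ℤ → ℂ} (hq0 : q ≠ 0)
    (hg : ∀ i, g (i + 1) = -q ^ i * g i)
    {x : ℂ} (hx0 : x ≠ 0) (hx : ∀ i : ℤ, 1 - x * q ^ i ≠ 0)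
    (h2 : ∀ K : ℤ, Summable fun i => g i * q ^ i * q ^ (-(K * i)) / (1 - x * q ^ i)) (K : ℤ) :
    ∑' i, g i * q ^ i * q ^ (-(K * i)) / (1 - x * q ^ i) =
      x ^ K * ∑' i, g i * q ^ i / (1 - x * q ^ i) := by
  have hstep : ∀ K : ℤ, ∑' i, g i * q ^ i * q ^ (-((K + 1) * i)) / (1 - x * q ^ i) =
      x * ∑' i, g i * q ^ i * q ^ (-(K * i)) / (1 - x * q ^ i) := by
    intro K
    rw [← tsum_mul_left, ← sub_eq_zero, ← (h2 (K + 1)).tsum_sub ((h2 K).mul_left x)]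
    have e : ∀ i, g i * q ^ i * q ^ (-((K + 1) * i)) / (1 - x * q ^ i) -
        x * (g i * q ^ i * q ^ (-(K * i)) / (1 - x * q ^ i)) = g i * q ^ (-(K * i)) := by
      intro i
      have h := hx i
      have h' : q ^ (-((K + 1) * i)) = q ^ (-(K * i)) / q ^ i := by
        rw [← zpow_sub₀ hq0]; congr 1; ring
      rw [h']
      have := zpow_ne_zero i hq0
      have h3 : 1 - q ^ i * x ≠ 0 := by rwa [mul_comm] at h
      field_simp
    simp_rw [e]
    have hanti : ∀ i, g (2 * K + 1 - i) * q ^ (-(K * (2 * K + 1 - i))) = - (g i * q ^ (-(K * i))) := by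
      have base : ∀ n : ℤ, g (K + 1 + n) * q ^ (-(K * (K + 1 + n))) =
          -(g (K - n) * q ^ (-(K * (K - n)))) := by
        intro n
        induction n using Int.induction_on with
        | zero =>
          rw [add_zero, sub_zero, hg K, neg_mul, neg_mul]
          congr 1
          rw [mul_comm (q ^ K), mul_assoc, ← zpow_add₀ hq0]
          congr 2; ring
        | succ n ih =>
          have a1 := hg (K + 1 + n)
          have a2 := hg (K - (n + 1))
          rw [show K - ((n : ℤ) + 1) + 1 = K - n by ring] at a2
          rw [show K + 1 + (n : ℤ) + 1 = K + 1 + (n + 1) by ring] at a1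
          rw [a1]
          rw [a2] at ih
          have b1 : q ^ (-(K * (K + 1 + ((n : ℤ) + 1)))) = q ^ (-(K * (K + 1 + n))) * q ^ (-K) := by
            rw [← zpow_add₀ hq0]; congr 1; ring
          have b2 : q ^ (-(K * (K - ((n : ℤ) + 1)))) = q ^ (-(K * (K - n))) * q ^ K := by
            rw [← zpow_add₀ hq0]; congr 1; ring
          have b3 : q ^ (K + 1 + (n : ℤ)) * q ^ (-K) * q ^ (K - ((n : ℤ) + 1)) = q ^ K := by
            rw [← zpow_add₀ hq0, ← zpow_add₀ hq0]; congr 1; ring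
          rw [b1, b2]
          linear_combination (-(q ^ (K + 1 + (n : ℤ)) * q ^ (-K))) * ih -
            g (K - ((n : ℤ) + 1)) * q ^ (-(K * (K - n))) * b3
        | pred n ih =>
          have a1 := hg (K + 1 + (-n - 1))
          have a2 := hg (K - (-n))
          rw [show K + 1 + (-(n : ℤ) - 1) + 1 = K + 1 + -n by ring] at a1
          rw [show K - -(n : ℤ) + 1 = K - (-n - 1) by ring] at a2
          rw [a2]
          rw [a1] at ih
          have b1 : q ^ (-(K * (K + 1 + -(n : ℤ)))) = q ^ (-(K * (K + 1 + (-n - 1)))) * q ^ (-K) := by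
            rw [← zpow_add₀ hq0]; congr 1; ring
          have b2 : q ^ (-(K * (K - -(n : ℤ)))) = q ^ (-(K * (K - (-n - 1)))) * q ^ K := by
            rw [← zpow_add₀ hq0]; congr 1; ring
          have b3 : q ^ (K + 1 + (-(n : ℤ) - 1)) * q ^ (-K) * q ^ (K - -(n : ℤ)) = q ^ K := by
            rw [← zpow_add₀ hq0, ← zpow_add₀ hq0]; congr 1; ring
          rw [b1, b2] at ih
          have c : q ^ K ≠ 0 := zpow_ne_zero _ hq0
          apply mul_left_cancel₀ c
          linear_combination (-q ^ (K - -(n : ℤ))) * ih -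
            g (K + 1 + (-n - 1)) * q ^ (-(K * (K + 1 + (-(n : ℤ) - 1)))) * b3
      intro i
      have := base (K - i)
      rw [show K + 1 + (K - i) = 2 * K + 1 - i by ring, show K - (K - i) = i by ring] at this
      exact this
    have hh := (Equiv.subLeft (2 * K + 1)).tsum_eq (fun i => g i * q ^ (-(K * i)))
    simp only [Equiv.subLeft_apply, hanti, tsum_neg] at hh
    have : (2 : ℂ) * ∑' i, g i * q ^ (-(K * i)) = 0 := by linear_combination -hh
    simpa using this
  induction K using Int.induction_on with
  | zero => simp
  | succ n ih => rw [hstep, ih, zpow_add₀ hx0]; simp; ring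
  | pred n ih =>
    have := hstep (-n - 1)
    rw [sub_add_cancel, ih] at this
    apply mul_left_cancel₀ hx0
    rw [← this, ← mul_assoc, ← zpow_one_add₀ hx0]
    congr 2; ring
lemma norm_e2 (w : ℂ) : ‖e2 w‖ = Real.exp (-(2 * Real.pi * w.im)) := by
  rw [e2, Complex.norm_exp]
  congr 1
  simp

lemma e2_add (v w : ℂ) : e2 (v + w) = e2 v * e2 w := by
  rw [e2, e2, e2, ← Complex.exp_add]; congr 1; ring

lemma e2_int (k : ℤ) (w : ℂ) : e2 (k * w) = e2 w ^ k := by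
  rw [e2, e2, ← Complex.exp_int_mul]; congr 1; ring

lemma e2_nat (k : ℕ) (w : ℂ) : e2 (k * w) = e2 w ^ k := by
  rw [e2, e2, ← Complex.exp_nat_mul]; congr 1; ring

lemma e2_zero : e2 0 = 1 := by simp [e2]

lemma e2_ne (w : ℂ) : e2 w ≠ 0 := Complex.exp_ne_zero _

lemma e2_eq_one {w : ℂ} (h : e2 w = 1) : ∃ a : ℤ, w = a := by
  rw [e2, Complex.exp_eq_one_iff] at h
  obtain ⟨a, ha⟩ := h
  refine ⟨a, ?_⟩
  have : (2 * (Real.pi : ℂ) * I) ≠ 0 := Complex.two_pi_I_ne_zero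
  apply mul_left_cancel₀ this
  rw [ha]; ring

lemma gauss {τ : ℂ} (hτ : 0 < τ.im) {T : ℝ} (hT : 0 < T) (B C : ℂ) (D : ℝ) :
    Summable fun j : ℤ => Real.exp (D * |(j : ℝ)|) * ‖e2 (T * (j : ℂ) ^ 2 * τ + B * j + C)‖ := by
  have hp := Real.pi_pos
  have h := (summable_pow_mul_jacobiTheta₂_term_bound (|B.im| + |D| / (2 * Real.pi))
    (T := 2 * T * τ.im) (by positivity) 0).mul_left (Real.exp (-(2 * Real.pi * C.im)))
  refine h.of_nonneg_of_le (fun j => by positivity) fun j => ?_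
  rw [norm_e2, ← Real.exp_add, pow_zero, one_mul, ← Real.exp_add]
  apply Real.exp_le_exp.mpr
  have him : (T * (j : ℂ) ^ 2 * τ + B * j + C).im = T * (j : ℝ) ^ 2 * τ.im + B.im * j + C.im := by
    have : (T : ℂ) * (j : ℂ) ^ 2 = ((T * (j : ℝ) ^ 2 : ℝ) : ℂ) := by push_cast; rfl
    rw [this, Complex.add_im, Complex.add_im, Complex.im_ofReal_mul]
    simp
  rw [him]
  have h1 : -(B.im * j) ≤ |B.im| * |(j : ℝ)| := by
    rw [← abs_mul]; exact neg_le_abs _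
  have h2 : D * |(j : ℝ)| ≤ |D| * |(j : ℝ)| := by
    gcongr; exact le_abs_self D
  have h3 : -Real.pi * (2 * T * τ.im * (j : ℝ) ^ 2 - 2 * (|B.im| + |D| / (2 * Real.pi)) * |(j : ℝ)|)
      = -(2 * Real.pi * (T * (j : ℝ) ^ 2 * τ.im)) + 2 * Real.pi * (|B.im| * |(j : ℝ)|)
        + |D| * |(j : ℝ)| := by
    field_simp
    ring
  push_cast
  rw [h3]
  nlinarith [mul_le_mul_of_nonneg_left h1 (by positivity : 0 ≤ 2 * Real.pi)]

/-- sign of the range between `0` and `R` -/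
def sg (R k : ℤ) : ℂ := (if 0 ≤ k ∧ k < R then 1 else 0) - (if R ≤ k ∧ k < 0 then 1 else 0)

lemma sg_succ (R k : ℤ) : sg (R + 1) k = sg R k + (if k = R then 1 else 0) := by
  unfold sg
  split_ifs <;> first | omega | simp

lemma geom_hasSum {y : ℂ} (hy0 : y ≠ 0) (hy1 : y ≠ 1) (R : ℤ) :
    HasSum (fun k : ℤ => sg R k * y ^ k) ((1 - y ^ R) / (1 - y)) := by
  have h1 : 1 - y ≠ 0 := sub_ne_zero.mpr hy1.symm
  have hs : ∀ R : ℤ, HasSum (fun k : ℤ => (if k = R then 1 else 0) * y ^ k) (y ^ R) := by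
    intro R
    have := hasSum_single (f := fun k : ℤ => (if k = R then 1 else 0) * y ^ k) R
      (by intro b hb; simp [hb])
    simpa using this
  induction R using Int.induction_on with
  | zero =>
    have : (fun k : ℤ => sg 0 k * y ^ k) = fun _ => 0 := by
      ext k
      have : sg 0 k = 0 := by
        unfold sg; split_ifs <;> first | omega | simp
      simp [this]
    rw [this]; simp
  | succ n ih =>
    have := ih.add (hs n)
    convert this using 1
    · ext k; rw [sg_succ]; ring
    · rw [zpow_add₀ hy0]; field_simp; simp; ring
  | pred n ih =>
    have := ih.sub (hs (-n - 1))
    have hf : (fun k : ℤ => sg (-n - 1) k * y ^ k) =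
        fun k => sg (-n) k * y ^ k - (if k = -n - 1 then 1 else 0) * y ^ k := by
      ext k
      have := sg_succ (-n - 1) k
      rw [sub_add_cancel] at this
      rw [this]; ring
    have hv : (1 - y ^ (-(n : ℤ) - 1)) / (1 - y) =
        (1 - y ^ (-(n : ℤ))) / (1 - y) - y ^ (-(n : ℤ) - 1) := by
      rw [show y ^ (-(n : ℤ)) = y ^ (-(n : ℤ) - 1) * y by
        rw [← zpow_add_one₀ hy0]; congr 1; ring]
      field_simp; ring
    rw [hf, hv]; exact this

lemma zpow_mid {Y : ℝ} (hY : 0 < Y) {R k : ℤ} (h : (0 ≤ k ∧ k < R) ∨ (R ≤ k ∧ k < 0)) :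
    Y ^ k ≤ 1 + Y ^ R := by
  have hR : 0 < Y ^ R := zpow_pos hY R
  rcases le_total Y 1 with h1 | h1 <;> rcases h with ⟨ha, hb⟩ | ⟨ha, hb⟩
  · have := zpow_le_zpow_right_of_le_one₀ hY h1 ha
    rw [zpow_zero] at this; linarith
  · have := zpow_le_zpow_right_of_le_one₀ hY h1 ha
    linarith
  · have := zpow_le_zpow_right₀ h1 hb.le
    linarith
  · have := zpow_le_zpow_right₀ h1 hb.le
    rw [zpow_zero] at this; linarith

lemma double_sum (M : ℕ) (a b y : ℤ → ℂ) (hy0 : ∀ l, y l ≠ 0) (hy1 : ∀ l, y l ≠ 1)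
    (h1 : Summable fun p : ℤ × ℤ => Real.exp (M * |(p.1 : ℝ)|) * ‖a p.1 * b p.2‖)
    (h2 : Summable fun p : ℤ × ℤ =>
      Real.exp (M * |(p.1 : ℝ)|) * ‖a p.1 * b p.2 * y p.2 ^ ((M : ℤ) * p.1)‖) :
    ∑' p : ℤ × ℤ, ((if 0 ≤ p.2 ∧ p.2 < (M : ℤ) * p.1 then a p.1 * ∑' l, b l * y l ^ p.2 else 0) -
      (if (M : ℤ) * p.1 ≤ p.2 ∧ p.2 < 0 then a p.1 * ∑' l, b l * y l ^ p.2 else 0)) =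
    ∑' p : ℤ × ℤ, a p.1 * b p.2 * ((1 - y p.2 ^ ((M : ℤ) * p.1)) / (1 - y p.2)) := by
  let h : (ℤ × ℤ) × ℤ → ℂ := fun t => sg ((M : ℤ) * t.1.1) t.2 * (a t.1.1 * b t.1.2 * y t.1.2 ^ t.2)
  have hexp : Summable fun k : ℤ => Real.exp (-|(k : ℝ)|) := by
    have : Summable fun k : ℕ => Real.exp (-(k : ℝ)) := Real.summable_exp_neg_nat
    apply Summable.of_nat_of_neg <;> simpa using this
  have hsum : Summable h := by
    have hb := (h1.add h2).mul_of_nonneg hexp (fun p => by positivity) (fun k => by positivity)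
    refine Summable.of_norm_bounded hb ?_
    rintro ⟨⟨j, l⟩, k⟩
    simp only [h]
    by_cases hc : (0 ≤ k ∧ k < (M : ℤ) * j) ∨ ((M : ℤ) * j ≤ k ∧ k < 0)
    · have hsg : ‖sg ((M : ℤ) * j) k‖ = 1 := by
        unfold sg
        rcases hc with hc | hc
        · rw [if_pos hc, if_neg (by omega)]; simp
        · rw [if_pos hc, if_neg (by omega)]; simp
      have hk : |(k : ℝ)| ≤ M * |(j : ℝ)| := by
        have h3 : |k| ≤ |(M : ℤ) * j| := by
          rcases hc with hc | hc
          · rw [abs_of_nonneg hc.1]; exact hc.2.le.trans (le_abs_self _)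
          · rw [abs_of_neg hc.2, abs_of_neg (by omega)]; omega
        rw [abs_mul, Nat.abs_cast] at h3
        exact_mod_cast h3
      have hy := zpow_mid (norm_pos_iff.mpr (hy0 l)) hc
      rw [norm_mul, hsg, one_mul, norm_mul, norm_mul _ (y l ^ _), norm_zpow, norm_zpow]
      have he : 1 ≤ Real.exp (M * |(j : ℝ)|) * Real.exp (-|(k : ℝ)|) := by
        rw [← Real.exp_add]; apply Real.one_le_exp; linarith
      calc ‖a j * b l‖ * ‖y l‖ ^ k ≤ ‖a j * b l‖ * (1 + ‖y l‖ ^ ((M : ℤ) * j)) := by gcongr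
        _ ≤ (‖a j * b l‖ * (1 + ‖y l‖ ^ ((M : ℤ) * j))) *
            (Real.exp (M * |(j : ℝ)|) * Real.exp (-|(k : ℝ)|)) := by
          apply le_mul_of_one_le_right _ he
          have := zpow_pos (norm_pos_iff.mpr (hy0 l)) ((M : ℤ) * j)
          positivity
        _ = _ := by ring
    · have hsg : sg ((M : ℤ) * j) k = 0 := by
        rw [not_or] at hc
        unfold sg
        rw [if_neg hc.1, if_neg hc.2]; simp
      rw [hsg, zero_mul, norm_zero]
      positivity
  let φ : (ℤ × ℤ) × ℤ ≃ (ℤ × ℤ) × ℤ :=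
    { toFun := fun t => ((t.1.1, t.2), t.1.2)
      invFun := fun t => ((t.1.1, t.2), t.1.2)
      left_inv := fun t => rfl
      right_inv := fun t => rfl }
  have hsum' : Summable (h ∘ φ) := φ.summable_iff.mpr hsum
  have e1 : ∑' t, (h ∘ φ) t = ∑' t, h t := φ.tsum_eq h
  rw [hsum'.tsum_prod, hsum.tsum_prod] at e1
  convert e1 using 1
  · congr 1; ext ⟨j, k⟩
    simp only [h, φ, Function.comp, Equiv.coe_fn_mk]
    rw [tsum_mul_left]
    simp_rw [mul_assoc (a j)]
    rw [tsum_mul_left]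
    unfold sg
    split_ifs <;> simp
  · congr 1; ext ⟨j, l⟩
    simp only [h]
    rw [← (geom_hasSum (hy0 l) (hy1 l) ((M : ℤ) * j)).tsum_eq, ← tsum_mul_left]
    congr 1; ext k
    ring
/-- `(-1)^i q^{i(i-1)/2}` -/
def gg (τ : ℂ) (i : ℤ) : ℂ := (-1 : ℂ) ^ i * e2 ((i : ℂ) * (i - 1) / 2 * τ)

lemma gg_succ (τ : ℂ) (i : ℤ) : gg τ (i + 1) = -(e2 τ) ^ i * gg τ i := by
  rw [gg, gg, ← e2_int, zpow_add₀ (by norm_num), zpow_one]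
  have : e2 (((i + 1 : ℤ) : ℂ) * (((i + 1 : ℤ) : ℂ) - 1) / 2 * τ) =
      e2 (i * τ) * e2 ((i : ℂ) * (i - 1) / 2 * τ) := by
    rw [← e2_add]; congr 1; push_cast; ring
  rw [this]; ring

lemma norm_neg_one_zpow (i : ℤ) : ‖(-1 : ℂ) ^ i‖ = 1 := by
  rw [norm_zpow]; simp

lemma norm_q_lt {τ : ℂ} (hτ : 0 < τ.im) : ‖e2 τ‖ < 1 := by
  rw [norm_e2, Real.exp_lt_one_iff]
  have := Real.pi_pos
  have : 0 < 2 * Real.pi * τ.im := by positivity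
  linarith

lemma gg_summable {τ : ℂ} (hτ : 0 < τ.im) (w : ℂ) : Summable fun i => ‖gg τ i * e2 w ^ i‖ := by
  have h := gauss hτ (T := 1 / 2) (by norm_num) (w - τ / 2) 0 0
  refine h.congr fun i => ?_
  rw [gg, norm_mul, norm_mul, norm_neg_one_zpow, one_mul, zero_mul, Real.exp_zero, one_mul,
    ← norm_mul, ← e2_int, ← e2_add]
  congr 2; push_cast; ring

lemma gg_div_summable {τ : ℂ} (hτ : 0 < τ.im) (w z : ℂ) :
    Summable fun i : ℤ => ‖gg τ i * e2 w ^ i / (1 - e2 z * e2 τ ^ i)‖ := by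
  obtain ⟨C, hC⟩ := inv_bdd (norm_q_lt hτ) (e2_ne τ) (e2_ne z)
  refine ((gg_summable hτ w).mul_right C).of_nonneg_of_le (fun _ => norm_nonneg _) fun i => ?_
  rw [div_eq_mul_inv, norm_mul]
  gcongr
  exact hC i

lemma x_ne {τ z₁ : ℂ} (hz : ∀ a b : ℤ, z₁ ≠ (a : ℂ) + (b : ℂ) * τ) (i : ℤ) :
    e2 z₁ * e2 τ ^ i ≠ 1 := by
  rw [← e2_int, ← e2_add]
  intro h
  obtain ⟨a, ha⟩ := e2_eq_one h
  apply hz a (-i)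
  push_cast
  linear_combination ha

lemma eta_theta {τ : ℂ} (hτ : 0 < τ.im) {z₁ : ℂ}
    (hz : ∀ a b : ℤ, z₁ ≠ (a : ℂ) + (b : ℂ) * τ) :
    -Complex.I * dedekindEta τ ^ 3 / theta11 τ z₁ =
      e2 (z₁ / 2) * ∑' i, gg τ i * e2 τ ^ i / (1 - e2 z₁ * e2 τ ^ i) := by
  have hid := theta_mul_appell (norm_q_lt hτ) (e2_ne τ) (g := gg τ)
    (by simp [gg, e2_zero]) (gg_succ τ) (e2_ne z₁)
    (fun i => sub_ne_zero.mpr (x_ne hz i).symm) (gg_summable hτ z₁) (gg_div_summable hτ τ z₁)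
  have hQ := qQ_ne (norm_q_lt hτ)
  have heta : dedekindEta τ ^ 3 = e2 (τ / 8) * (∏' k : ℕ, (1 - e2 τ ^ (k + 1))) ^ 3 := by
    rw [dedekindEta, mul_pow]
    congr 1
    · rw [← e2_nat]; congr 1; push_cast; ring
    · congr 2; ext k; rw [← e2_nat]; push_cast; rfl
  have hth : theta11 τ z₁ = -Complex.I * e2 (τ / 8) * e2 (-(z₁ / 2)) * ∑' i, gg τ i * e2 z₁ ^ i := by
    rw [theta11, ← (Equiv.subRight (1 : ℤ)).tsum_eq, ← tsum_mul_left, ← tsum_mul_left]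
    congr 1; ext i
    simp only [Equiv.subRight_apply]
    have h1 : e2 ((((i - 1 : ℤ) : ℂ) + 1 / 2) ^ 2 / 2 * τ + (((i - 1 : ℤ) : ℂ) + 1 / 2) * z₁) =
        e2 (τ / 8) * e2 (-(z₁ / 2)) * (e2 ((i : ℂ) * (i - 1) / 2 * τ) * e2 (i * z₁)) := by
      rw [← e2_add, ← e2_add, ← e2_add]; congr 1; push_cast; ring
    rw [h1, gg, ← e2_int, zpow_sub₀ (by norm_num), zpow_one]
    ring
  have hT : ∑' i, gg τ i * e2 z₁ ^ i ≠ 0 := by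
    intro h
    rw [h, zero_mul] at hid
    exact pow_ne_zero 3 hQ hid.symm
  rw [heta, hth, ← hid]
  have h1 := e2_ne (τ / 8)
  have h2 := e2_ne (-(z₁ / 2))
  have h3 : e2 (z₁ / 2) * e2 (-(z₁ / 2)) = 1 := by rw [← e2_add, add_neg_cancel, e2_zero]
  have h4 := Complex.I_ne_zero
  rw [div_eq_iff (by simp [h1, h2, hT])]
  linear_combination (Complex.I * e2 (τ / 8) * (∑' i, gg τ i * e2 z₁ ^ i) *
    ∑' i, gg τ i * e2 τ ^ i / (1 - e2 z₁ * e2 τ ^ i)) * h3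

set_option maxHeartbeats 1000000 in
theorem stmt_4 (M : ℕ) (hM : 0 < M) (m : ℂ) (hm : m = (M : ℂ) / 2)
    (S : ℤ) (s : ℂ) (hs : s = (S : ℂ) + 1 / 2)
    (τ : ℂ) (hτ : 0 < τ.im) (z₁ z₂ : ℂ)
    (hz : ∀ a b : ℤ, z₁ ≠ (a : ℂ) + (b : ℂ) * τ) :
    jtheta (-1) s (m + 1 / 2) τ (-(2 * m * (z₁ - z₂)) / (2 * m + 1)) * Phi1 1 m 0 τ z₁ z₂ -
      e2 (-(m * s * (z₁ - z₂)) / (2 * m + 1)) *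
        (∑' jk : ℤ × ℤ,
          ((if 0 ≤ jk.2 ∧ jk.2 < (M : ℤ) * jk.1 then
              fcoef m s τ z₁ z₂ jk.1 jk.2 * jtheta 1 (jk.2 : ℂ) m τ (z₁ + z₂) else 0) -
            (if (M : ℤ) * jk.1 ≤ jk.2 ∧ jk.2 < 0 then
              fcoef m s τ z₁ z₂ jk.1 jk.2 * jtheta 1 (jk.2 : ℂ) m τ (z₁ + z₂) else 0))) =
      -Complex.I * jtheta (-1) s (m + 1 / 2) τ (z₁ + z₂ + (z₁ - z₂) / (2 * m + 1)) *
        dedekindEta τ ^ 3 / theta11 τ z₁ := by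
  have hMpos : (0 : ℝ) < M := by exact_mod_cast hM
  have hMC : (M : ℂ) ≠ 0 := by exact_mod_cast hM.ne'
  have hm0 : m ≠ 0 := by rw [hm]; simpa using hMC
  have hm1 : 2 * m + 1 ≠ 0 := by
    rw [hm, mul_div_cancel₀ _ two_ne_zero]; exact_mod_cast Nat.succ_ne_zero M
  have hM2 : (M : ℂ) = 2 * m := by rw [hm]; ring
  obtain ⟨c, hc⟩ : ∃ c, s / (2 * m + 1) = c := ⟨_, rfl⟩
  have hsc : s = (2 * m + 1) * c := by rw [← hc]; field_simp
  set w := z₁ - z₂ with hw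
  set u := z₁ + z₂ with hu
  have hz1 : z₁ = (u + w) / 2 := by rw [hw, hu]; ring
  obtain ⟨a, da⟩ : ∃ F : ℤ → ℂ, F = fun (j : ℤ) => (-1 : ℂ) ^ j *
    e2 ((m + 1 / 2) * ((j : ℂ) + s / (2 * m + 1)) ^ 2 * τ - j * m * w) :=
    ⟨_, rfl⟩
  obtain ⟨b, db⟩ : ∃ F : ℤ → ℂ, F = fun (l : ℤ) => e2 (m * l * u + m * (l : ℂ) ^ 2 * τ) :=
    ⟨_, rfl⟩
  obtain ⟨y, dy⟩ : ∃ F : ℤ → ℂ, F = fun (l : ℤ) => e2 z₁ * e2 τ ^ l :=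
    ⟨_, rfl⟩
  have hyE : ∀ l, y l = e2 (z₁ + l * τ) := fun l => by
    simp only [dy]; rw [e2_add, e2_int]
  have hy0 : ∀ l, y l ≠ 0 := fun l => by
    rw [dy]; exact mul_ne_zero (e2_ne _) (zpow_ne_zero _ (e2_ne _))
  have hy1 : ∀ l, y l ≠ 1 := fun l => by rw [dy]; exact x_ne hz l
  obtain ⟨C, hC⟩ := inv_bdd (norm_q_lt hτ) (e2_ne τ) (e2_ne z₁)
  have hC0 : 0 ≤ C := (norm_nonneg _).trans (hC 0)
  have H0 : 2 * (m + 1 / 2) = 2 * m + 1 := by ring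
  have H1 : ∀ X, (m + 1 / 2) * (X / (2 * m + 1)) = X / 2 := by
    intro X; rw [show m + 1 / 2 = (2 * m + 1) / 2 by ring]; field_simp
  have H2 : -(m * s * w) / (2 * m + 1) = -(m * c * w) := by
    rw [← hc]; field_simp
  -- the pieces of the left-hand side
  have hjt : jtheta (-1) s (m + 1 / 2) τ (-(2 * m * w) / (2 * m + 1)) =
      e2 (-(m * s * w) / (2 * m + 1)) * ∑' j, a j := by
    rw [jtheta, ← tsum_mul_left]
    congr 1; ext j
    simp only [da]
    rw [mul_left_comm, ← e2_add]
    congr 2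
    rw [H0, H2, hc]
    linear_combination ((j : ℂ) + c) * H1 (-(2 * m * w))
  have hphi : Phi1 1 m 0 τ z₁ z₂ = ∑' l, b l / (1 - y l) := by
    rw [Phi1]
    congr 1; ext l
    rw [hyE]
    simp only [db, one_zpow, one_mul, zero_mul, add_zero, ← hu]
  have hf : ∀ j k : ℤ, fcoef m s τ z₁ z₂ j k * jtheta 1 (k : ℂ) m τ u =
      a j * ∑' l, b l * y l ^ k := by
    intro j k
    rw [jtheta, ← tsum_mul_left, ← tsum_mul_left]
    congr 1; ext l
    rw [hyE, ← e2_int]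
    simp only [da, db, fcoef, one_zpow, one_mul, ← hw]
    rw [mul_assoc ((-1 : ℂ) ^ j), mul_assoc ((-1 : ℂ) ^ j), ← e2_add, ← e2_add, ← e2_add]
    congr 2
    rw [hz1, hc]
    field_simp
    ring
  -- factorization of the shifted terms
  obtain ⟨α, dα⟩ : ∃ F : ℤ → ℂ, F = fun (j : ℤ) => (-1 : ℂ) ^ j * e2 (((j : ℂ) ^ 2 / 2 + s * j) * τ) :=
    ⟨_, rfl⟩
  obtain ⟨β, dβ⟩ : ∃ F : ℤ → ℂ, F = fun (n : ℤ) => e2 (s * c / 2 * τ + m * (n : ℂ) ^ 2 * τ + n * m * u) :=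
    ⟨_, rfl⟩
  have hab : ∀ j l : ℤ, a j * b l * y l ^ ((M : ℤ) * j) = α j * β (l + j) := by
    intro j l
    rw [hyE, ← e2_int]
    simp only [da, db, dα, dβ]
    rw [mul_assoc ((-1 : ℂ) ^ j), mul_assoc ((-1 : ℂ) ^ j), mul_assoc ((-1 : ℂ) ^ j),
      ← e2_add, ← e2_add, ← e2_add]
    congr 2
    push_cast
    rw [hM2, hz1, hc, hsc]
    ring
  have hsα : ∀ D : ℝ, Summable fun j : ℤ => Real.exp (D * |(j : ℝ)|) * ‖α j‖ := by
    intro D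
    refine (gauss hτ (T := 1 / 2) (by norm_num) (s * τ) 0 D).congr fun j => ?_
    simp only [dα]
    rw [norm_mul, norm_neg_one_zpow, one_mul]
    congr 3; push_cast; ring
  have hsβ : Summable fun n : ℤ => ‖β n‖ := by
    refine (gauss hτ (T := M / 2) (by positivity) (m * u)
      (s * c / 2 * τ) 0).congr fun n => ?_
    simp only [dβ]
    rw [zero_mul, Real.exp_zero, one_mul]
    congr 2; push_cast; rw [hm]; ring
  have hsa : ∀ D : ℝ, Summable fun j : ℤ => Real.exp (D * |(j : ℝ)|) * ‖a j‖ := by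
    intro D
    refine (gauss hτ (T := M / 2 + 1 / 2) (by positivity) (s * τ - m * w)
      (s * c / 2 * τ) D).congr fun j => ?_
    simp only [da]
    rw [norm_mul, norm_neg_one_zpow, one_mul]
    congr 2; push_cast; rw [← hm, hc, hsc]
    ring_nf
  have hsb : Summable fun l : ℤ => ‖b l‖ := by
    refine (gauss hτ (T := M / 2) (by positivity) (m * u) 0 0).congr fun n => ?_
    simp only [db]
    rw [zero_mul, Real.exp_zero, one_mul]
    congr 2; push_cast; rw [hm]; ring
  have h1 : Summable fun p : ℤ × ℤ => Real.exp (M * |(p.1 : ℝ)|) * ‖a p.1 * b p.2‖ := by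
    refine ((hsa M).mul_of_nonneg hsb (fun _ => by positivity) (fun _ => by positivity)).congr
      fun p => ?_
    rw [norm_mul (a p.1) (b p.2), mul_assoc]
  let ψ : ℤ × ℤ ≃ ℤ × ℤ :=
    { toFun := fun p => (p.1, p.2 + p.1)
      invFun := fun p => (p.1, p.2 - p.1)
      left_inv := fun p => by simp
      right_inv := fun p => by simp }
  have hαβ : ∀ D : ℝ, Summable fun p : ℤ × ℤ =>
      Real.exp (D * |(p.1 : ℝ)|) * ‖a p.1 * b p.2 * y p.2 ^ ((M : ℤ) * p.1)‖ := by
    intro D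
    have h := ψ.summable_iff.mpr
      ((hsα D).mul_of_nonneg hsβ (fun _ => by positivity) (fun _ => by positivity))
    refine h.congr fun p => ?_
    rw [hab, norm_mul]
    simp only [Function.comp, ψ, Equiv.coe_fn_mk]
    ring
  have hD := double_sum M a b y hy0 hy1 h1 (hαβ M)
  simp_rw [hf]
  rw [hD, hjt, hphi]
  -- combine
  have hinv : ∀ l, ‖(1 - y l)⁻¹‖ ≤ C := fun l => by rw [dy]; exact hC l
  have hsa0 : Summable fun j => ‖a j‖ := (hsa 0).congr fun j => by simp
  have hsb0 : Summable fun l => ‖b l / (1 - y l)‖ := by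
    refine (hsb.mul_right C).of_nonneg_of_le (fun _ => norm_nonneg _) fun l => ?_
    rw [div_eq_mul_inv, norm_mul]
    gcongr
    exact hinv l
  have hs1 : Summable fun p : ℤ × ℤ => a p.1 * (b p.2 / (1 - y p.2)) :=
    summable_mul_of_summable_norm (f := a) (g := fun l => b l / (1 - y l)) hsa0 hsb0
  have hs3 : Summable fun p : ℤ × ℤ =>
      a p.1 * b p.2 * y p.2 ^ ((M : ℤ) * p.1) / (1 - y p.2) := by
    have h0 : Summable fun p : ℤ × ℤ => ‖a p.1 * b p.2 * y p.2 ^ ((M : ℤ) * p.1)‖ :=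
      (hαβ 0).congr fun p => by rw [zero_mul, Real.exp_zero, one_mul]
    refine Summable.of_norm_bounded (h0.mul_right C) fun p => ?_
    rw [div_eq_mul_inv, norm_mul _ (1 - y p.2)⁻¹]
    exact mul_le_mul_of_nonneg_left (hinv _) (norm_nonneg _)
  have hdec : ∀ p : ℤ × ℤ, a p.1 * b p.2 * ((1 - y p.2 ^ ((M : ℤ) * p.1)) / (1 - y p.2)) =
      a p.1 * (b p.2 / (1 - y p.2)) -
        a p.1 * b p.2 * y p.2 ^ ((M : ℤ) * p.1) / (1 - y p.2) := fun p => by ring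
  have hsum : (∑' j, a j) * (∑' l, b l / (1 - y l)) =
      ∑' p : ℤ × ℤ, a p.1 * (b p.2 / (1 - y p.2)) :=
    tsum_mul_tsum_of_summable_norm (f := a) (g := fun l => b l / (1 - y l)) hsa0 hsb0
  have hsub := hs1.tsum_sub hs3
  rw [tsum_congr hdec, hsub, mul_assoc, hsum, ← mul_sub, sub_sub_cancel]
  -- reindex
  let χ : ℤ × ℤ ≃ ℤ × ℤ :=
    { toFun := fun p => (p.1 - p.2, p.2)
      invFun := fun p => (p.1 + p.2, p.2)
      left_inv := fun p => by simp
      right_inv := fun p => by simp }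
  rw [← χ.tsum_eq]
  have hs4 := χ.summable_iff.mpr hs3
  have hs5 := hs4.tsum_prod
  simp only [Function.comp] at hs5
  rw [hs5]
  have hterm : ∀ n l : ℤ, a (n - l) * b l * y l ^ ((M : ℤ) * (n - l)) / (1 - y l) =
      ((-1 : ℂ) ^ n * e2 ((m + 1 / 2) * ((n : ℂ) + s / (2 * m + 1)) ^ 2 * τ + n * m * u)) *
      (gg τ l * e2 τ ^ l * e2 τ ^ (-((n + S + 1) * l)) / (1 - e2 z₁ * e2 τ ^ l)) := by
    intro n l
    have hyl : y l = e2 z₁ * e2 τ ^ l := by rw [dy]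
    rw [← hyl, ← mul_div_assoc]
    congr 1
    rw [hyE, ← e2_int, ← e2_int, ← e2_int]
    simp only [da, db, gg]
    have hsgn : (-1 : ℂ) ^ (n - l) = (-1) ^ n * (-1) ^ l := by
      rw [sub_eq_add_neg, zpow_add₀ (by norm_num), zpow_neg, ← inv_zpow]; norm_num
    have hexp : e2 ((m + 1 / 2) * (((n - l : ℤ) : ℂ) + s / (2 * m + 1)) ^ 2 * τ -
          ((n - l : ℤ) : ℂ) * m * w) * e2 (m * l * u + m * (l : ℂ) ^ 2 * τ) *
          e2 (((M * (n - l) : ℤ) : ℂ) * (z₁ + l * τ)) =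
        e2 ((m + 1 / 2) * ((n : ℂ) + s / (2 * m + 1)) ^ 2 * τ + n * m * u) *
          (e2 ((l : ℂ) * (l - 1) / 2 * τ) * e2 (l * τ) *
            e2 (((-((n + S + 1) * l) : ℤ) : ℂ) * τ)) := by
      rw [← e2_add, ← e2_add, ← e2_add, ← e2_add, ← e2_add]
      congr 1
      push_cast
      rw [hM2, hz1, show (S : ℂ) = s - 1 / 2 by rw [hs]; ring, hc, hsc]
      ring
    rw [hsgn]
    linear_combination ((-1 : ℂ) ^ n * (-1) ^ l) * hexp
  have hinner : ∀ n : ℤ, ∑' l : ℤ, a (n - l) * b l * y l ^ ((M : ℤ) * (n - l)) / (1 - y l) =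
      ((-1 : ℂ) ^ n * e2 ((m + 1 / 2) * ((n : ℂ) + s / (2 * m + 1)) ^ 2 * τ + n * m * u)) *
      (e2 z₁ ^ (n + S + 1) * ∑' i, gg τ i * e2 τ ^ i / (1 - e2 z₁ * e2 τ ^ i)) := by
    intro n
    simp_rw [hterm]
    rw [tsum_mul_left, appell_shift (e2_ne τ) (gg_succ τ) (e2_ne z₁)
      (fun i => sub_ne_zero.mpr (x_ne hz i).symm)]
    intro K
    refine (Summable.of_norm (gg_div_summable hτ (τ - K * τ) z₁)).congr fun i => ?_
    congr 1
    rw [mul_assoc]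
    congr 1
    rw [← e2_int, ← e2_int, ← e2_int, ← e2_add]
    congr 1; push_cast; ring
  simp only [χ, Equiv.coe_fn_mk]
  simp_rw [hinner]
  have hR : ∀ X : ℂ, -Complex.I * X * dedekindEta τ ^ 3 / theta11 τ z₁ =
      X * (-Complex.I * dedekindEta τ ^ 3 / theta11 τ z₁) := fun X => by ring
  rw [hR, eta_theta hτ hz, jtheta, ← tsum_mul_left,
    ← tsum_mul_right]
  congr 1; ext n
  have hfin : e2 (-(m * s * w) / (2 * m + 1)) *
      (e2 ((m + 1 / 2) * ((n : ℂ) + s / (2 * m + 1)) ^ 2 * τ + n * m * u) * e2 z₁ ^ (n + S + 1)) =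
      e2 ((m + 1 / 2) * ((n : ℂ) + s / (2 * (m + 1 / 2))) ^ 2 * τ +
        (m + 1 / 2) * ((n : ℂ) + s / (2 * (m + 1 / 2))) * (u + w / (2 * m + 1))) *
      e2 (z₁ / 2) := by
    rw [← e2_int, ← e2_add, ← e2_add, ← e2_add]
    congr 1
    rw [H0, H2, hc]
    push_cast
    rw [hz1, show (S : ℂ) = (2 * m + 1) * c - 1 / 2 by rw [← hsc, hs]; ring]
    linear_combination (-((n : ℂ) + c)) * H1 w
  linear_combination ((-1 : ℂ) ^ n * ∑' i, gg τ i * e2 τ ^ i / (1 - e2 z₁ * e2 τ ^ i)) * hfin
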